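/- Let F be a distribution function on [0,∞), let 0 < γ ≤ 1, and define Θ_γ(x) := (1/γ)[ log(1 + ∫_{[0,∞)} e^{−2xt} dF(t)) − γ( x log x + (1−x) log(1−x) + log 2 ) ] for x ∈ [0,1] (with 0·log 0 = 0). If ∫_{[0,∞)} t dF(t) < ∞, then sup_{x∈[0,1]} Θ_γ(x) > Θ_γ(0) = (1/γ − 1) log 2. -/

import Mathlib

open MeasureTheory Filter Topology

/-- The tangent-line bound `x - 1 ≤ x log x` at `x = 1`. -/
lemma sub_one_le_mul_log {x : ℝ} (hx : 0 ≤ x) : x - 1 ≤ x * Real.log x := by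
  rcases hx.eq_or_lt with rfl | hx
  · simp
  · have h := mul_le_mul_of_nonneg_left (Real.one_sub_inv_le_log_of_pos hx) hx.le
    rwa [mul_sub, mul_one, mul_inv_cancel₀ hx.ne'] at h

/-- The Laplace transform of a measure carried by `[0, ∞)` has an a.e. integrand at most `1`. -/
lemma ae_exp_neg_two_mul_le_one {μ : Measure ℝ} (hnonneg : ∀ᵐ t ∂μ, 0 ≤ t) {x : ℝ} (hx : 0 ≤ x) :
    ∀ᵐ t ∂μ, Real.exp (-2 * x * t) ≤ 1 := by
  filter_upwards [hnonneg] with t ht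
  rw [Real.exp_le_one_iff]
  nlinarith [mul_nonneg hx ht]

lemma integrable_exp_neg_two_mul {μ : Measure ℝ} [IsFiniteMeasure μ]
    (hnonneg : ∀ᵐ t ∂μ, 0 ≤ t) {x : ℝ} (hx : 0 ≤ x) :
    Integrable (fun t ↦ Real.exp (-2 * x * t)) μ := by
  refine Integrable.of_bound (by fun_prop) 1 ?_
  filter_upwards [ae_exp_neg_two_mul_le_one hnonneg hx] with t ht
  rwa [Real.norm_of_nonneg (Real.exp_pos _).le]

lemma integral_exp_neg_two_mul_le_one {μ : Measure ℝ} [IsProbabilityMeasure μ]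
    (hnonneg : ∀ᵐ t ∂μ, 0 ≤ t) {x : ℝ} (hx : 0 ≤ x) :
    ∫ t, Real.exp (-2 * x * t) ∂μ ≤ 1 := by
  simpa using integral_mono_ae (integrable_exp_neg_two_mul hnonneg hx) (integrable_const 1)
    (ae_exp_neg_two_mul_le_one hnonneg hx)

/-- Comparison of the Laplace transform with its tangent line at `0`. -/
lemma one_sub_mul_mean_le_integral_exp {μ : Measure ℝ} [IsProbabilityMeasure μ]
    (hnonneg : ∀ᵐ t ∂μ, 0 ≤ t) (hint : Integrable (fun t : ℝ ↦ t) μ) {x : ℝ} (hx : 0 ≤ x) :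
    1 - 2 * x * ∫ t, t ∂μ ≤ ∫ t, Real.exp (-2 * x * t) ∂μ := by
  have h : ∫ t, (1 - 2 * x * t) ∂μ = 1 - 2 * x * ∫ t, t ∂μ := by
    rw [integral_sub (integrable_const 1) (hint.const_mul _), integral_const_mul]
    simp
  rw [← h]
  refine integral_mono ((integrable_const 1).sub (hint.const_mul _))
    (integrable_exp_neg_two_mul hnonneg hx) fun t ↦ ?_
  have := Real.add_one_le_exp (-2 * x * t)
  dsimp only
  linarith

/-- If the mixing distribution has a finite first moment, then the
growth-rate functional `Θ_γ` attains values strictly above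
`Θ_γ(0) = (1/γ − 1) log 2` on `[0,1]`. -/
theorem sup_theta_gt_at_zero
    (γ : ℝ) (hγ0 : 0 < γ) (hγ1 : γ ≤ 1)
    (μ : Measure ℝ) (hμprob : IsProbabilityMeasure μ)
    (hsupp : μ (Set.Iio (0 : ℝ)) = 0)
    (hint : Integrable (fun t : ℝ => t) μ)
    (Θ : ℝ → ℝ)
    (hΘ : ∀ x : ℝ, Θ x = (1 / γ) *
      (Real.log (1 + ∫ t, Real.exp (-2 * x * t) ∂μ) -
        γ * (x * Real.log x + (1 - x) * Real.log (1 - x) + Real.log 2))) :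
    Θ 0 = (1 / γ - 1) * Real.log 2 ∧
    Θ 0 < sSup (Θ '' Set.Icc (0 : ℝ) 1) := by
  have hnonneg : ∀ᵐ t ∂μ, 0 ≤ t := by
    rw [ae_iff]
    simp only [not_le]
    exact hsupp
  have hzero : Θ 0 = (1 / γ) * (Real.log 2 - γ * Real.log 2) := by
    rw [hΘ]
    norm_num
  refine ⟨by rw [hzero]; field_simp, ?_⟩
  have hbdd : BddAbove (Θ '' Set.Icc (0 : ℝ) 1) := by
    refine ⟨(1 / γ) * (Real.log 2 - γ * (-1 + Real.log 2)), ?_⟩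
    rintro _ ⟨x, ⟨hx0, hx1⟩, rfl⟩
    have hL0 : 0 ≤ ∫ t, Real.exp (-2 * x * t) ∂μ := integral_nonneg fun t ↦ (Real.exp_pos _).le
    have hL1 := integral_exp_neg_two_mul_le_one hnonneg hx0
    have hlog := Real.log_le_log (by linarith : 0 < 1 + ∫ t, Real.exp (-2 * x * t) ∂μ)
      (by linarith : _ ≤ (2 : ℝ))
    have h1 := sub_one_le_mul_log hx0
    have h2 := sub_one_le_mul_log (sub_nonneg.mpr hx1)
    rw [hΘ]
    gcongr
    linarith
  have hm : 0 ≤ ∫ t, t ∂μ := integral_nonneg_of_ae hnonneg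
  set m := ∫ t, t ∂μ with hm_def
  set x := Real.exp (-(2 * m / γ + 1)) with hx_def
  have hx0 : 0 < x := Real.exp_pos _
  have hmγ : 2 * m ≤ 2 * m / γ := le_div_self (by positivity) hγ0 hγ1
  have hx1 : x ≤ 1 := Real.exp_le_one_iff.mpr (by linarith)
  have hxm : x * m ≤ 1 / 2 := by
    have h : x * Real.exp (2 * m / γ + 1) = 1 := by rw [hx_def, ← Real.exp_add]; simp
    have := Real.add_one_le_exp (2 * m / γ + 1)
    nlinarith
  have hlogL : Real.log 2 - 2 * (x * m) ≤ Real.log (1 + ∫ t, Real.exp (-2 * x * t) ∂μ) := by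
    have hpos : 0 < 1 - x * m := by linarith
    have h1 : Real.log (2 * (1 - x * m)) ≤ Real.log (1 + ∫ t, Real.exp (-2 * x * t) ∂μ) := by
      refine Real.log_le_log (by positivity) ?_
      have := one_sub_mul_mean_le_integral_exp hnonneg hint hx0.le
      linarith
    have h2 := Real.one_sub_inv_le_log_of_pos hpos
    have h3 : (1 - x * m)⁻¹ ≤ 1 + 2 * (x * m) := by
      rw [inv_le_iff_one_le_mul₀ hpos]
      nlinarith [mul_nonneg hx0.le hm]
    rw [Real.log_mul two_ne_zero hpos.ne'] at h1
    linarith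
  have hent : (1 - x) * Real.log (1 - x) ≤ 0 :=
    mul_nonpos_of_nonneg_of_nonpos (by linarith)
      (Real.log_nonpos (by linarith) (by linarith))
  have hxlog : γ * (x * Real.log x) = -(2 * (x * m)) - γ * x := by
    rw [show Real.log x = -(2 * m / γ + 1) from Real.log_exp _]
    field_simp
    ring
  refine lt_of_lt_of_le ?_ (le_csSup hbdd ⟨x, ⟨hx0.le, hx1⟩, rfl⟩)
  rw [hzero, hΘ]
  refine mul_lt_mul_of_pos_left ?_ (by positivity)
  nlinarith [mul_pos hγ0 hx0, mul_nonneg hγ0.le (neg_nonneg.mpr hent)]
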